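/- Let n ≥ 1, let m be a positive multiple of 4, and let σ > 0. On a probability space, let {Y_j}_{j<n}, {Z¹⁰_i}_{i<m/4}, {Z¹¹_i}_{i<m/4}, {Z²⁰_i}_{i<m/4}, {Z²²_i}_{i<m/4} be a jointly independent family of square-integrable real random variables, each with variance σ², where each Y_j has mean η₀+η₁+η₂+θ, each Z¹⁰_i and Z²⁰_i has mean η₀, each Z¹¹_i has mean η₀+η₁, and each Z²²_i has mean η₀+η₂. Define η̂₀ = (Σᵢ Z¹⁰_i + Σᵢ Z²⁰_i)/(m/2), η̂₁ = (Σᵢ Z¹¹_i)/(m/4) − η̂₀, η̂₂ = (Σᵢ Z²²_i)/(m/4) − η̂₀, and θ̄_A = (Σⱼ Y_j)/n − (η̂₀ + η̂₁ + η̂₂). Then E[θ̄_A] = θ and Var(θ̄_A) = σ²(1/n + 10/m). -/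

import Mathlib

open MeasureTheory ProbabilityTheory

/-- The variance of a linear combination of independent square-integrable random variables. -/
theorem variance_sum_const_mul_of_iIndepFun {Ω ι : Type*} [MeasurableSpace Ω] {μ : Measure Ω}
    [IsProbabilityMeasure μ] [Fintype ι] {X : ι → Ω → ℝ} (hX : iIndepFun X μ)
    (hL2 : ∀ i, MemLp (X i) 2 μ) (c : ι → ℝ) :
    variance (fun ω => ∑ i, c i * X i ω) μ = ∑ i, c i ^ 2 * variance (X i) μ := by
  have hsum : (fun ω => ∑ i, c i * X i ω) = ∑ i, fun ω => c i * X i ω := by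
    ext ω
    simp
  rw [hsum, IndepFun.variance_sum (fun i _ => (hL2 i).const_mul (c i))]
  · simp [variance_const_mul]
  · intro i _ j _ hij
    exact (hX.indepFun hij).comp (measurable_const_mul (c i)) (measurable_const_mul (c j))

/-- Type I design in the two-way ANOVA: all `n` current observations receive
both treatments, and `θ̄_A = Ȳ₁₂ − (η̂₀ + η̂₁ + η̂₂)` is unbiased for `θ` with
exact variance `σ²(1/n + 10/m)` (here `m = 4k` and the two balanced historical
studies each have `k` observations per arm). -/
theorem typeI_anova_mean_variance
    {Ω : Type*} [MeasurableSpace Ω] (μ : Measure Ω) [IsProbabilityMeasure μ]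
    (n : ℕ) (hn : 1 ≤ n) (m k : ℕ) (hm : m = 4 * k) (hk : 0 < k)
    (σ θ η₀ η₁ η₂ : ℝ) (hσ : 0 < σ)
    (Y : Fin n → Ω → ℝ) (Z10 Z11 Z20 Z22 : Fin k → Ω → ℝ)
    (hindep : iIndepFun
      (Sum.elim Y (Sum.elim (Sum.elim Z10 Z11) (Sum.elim Z20 Z22))) μ)
    (hL2Y : ∀ j, MemLp (Y j) 2 μ)
    (hL2 : ∀ i, MemLp (Z10 i) 2 μ ∧ MemLp (Z11 i) 2 μ ∧
      MemLp (Z20 i) 2 μ ∧ MemLp (Z22 i) 2 μ)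
    (hmeanY : ∀ j, ∫ ω, Y j ω ∂μ = η₀ + η₁ + η₂ + θ)
    (hmean10 : ∀ i, ∫ ω, Z10 i ω ∂μ = η₀)
    (hmean20 : ∀ i, ∫ ω, Z20 i ω ∂μ = η₀)
    (hmean11 : ∀ i, ∫ ω, Z11 i ω ∂μ = η₀ + η₁)
    (hmean22 : ∀ i, ∫ ω, Z22 i ω ∂μ = η₀ + η₂)
    (hvarY : ∀ j, variance (Y j) μ = σ ^ 2)
    (hvar : ∀ i, variance (Z10 i) μ = σ ^ 2 ∧ variance (Z11 i) μ = σ ^ 2 ∧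
      variance (Z20 i) μ = σ ^ 2 ∧ variance (Z22 i) μ = σ ^ 2)
    (ηhat₀ ηhat₁ ηhat₂ θbarA : Ω → ℝ)
    (h0 : ηhat₀ = fun ω => ((∑ i, Z10 i ω) + ∑ i, Z20 i ω) / ((m : ℝ) / 2))
    (h1 : ηhat₁ = fun ω => (∑ i, Z11 i ω) / ((m : ℝ) / 4) - ηhat₀ ω)
    (h2 : ηhat₂ = fun ω => (∑ i, Z22 i ω) / ((m : ℝ) / 4) - ηhat₀ ω)
    (hθ : θbarA = fun ω => (∑ j, Y j ω) / (n : ℝ) - (ηhat₀ ω + ηhat₁ ω + ηhat₂ ω)) :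
    (∫ ω, θbarA ω ∂μ) = θ ∧
      variance θbarA μ = σ ^ 2 * (1 / n + 10 / m) := by
  have hn' : (n : ℝ) ≠ 0 := by positivity
  have hk' : (k : ℝ) ≠ 0 := by positivity
  have hm' : (m : ℝ) = 4 * k := by simp [hm]
  let X := Sum.elim Y (Sum.elim (Sum.elim Z10 Z11) (Sum.elim Z20 Z22))
  let c : Fin n ⊕ ((Fin k ⊕ Fin k) ⊕ (Fin k ⊕ Fin k)) → ℝ :=
    Sum.elim (fun _ => 1 / n)
      (Sum.elim (Sum.elim (fun _ => 1 / (2 * k)) (fun _ => -1 / k))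
        (Sum.elim (fun _ => 1 / (2 * k)) (fun _ => -1 / k)))
  have hX : ∀ i, MemLp (X i) 2 μ := by
    rintro (j | (i | i) | (i | i))
    exacts [hL2Y j, (hL2 i).1, (hL2 i).2.1, (hL2 i).2.2.1, (hL2 i).2.2.2]
  have hθX : θbarA = fun ω => ∑ i, c i * X i ω := by
    ext ω
    simp only [hθ, h1, h2, h0, hm', X, c, Fintype.sum_sum_type, Sum.elim_inl, Sum.elim_inr,
      ← Finset.mul_sum]
    field_simp
    ring
  constructor
  · rw [hθX, integral_finsetSum _ fun i _ => ((hX i).integrable one_le_two).const_mul (c i)]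
    simp only [integral_const_mul, X, c, Fintype.sum_sum_type, Sum.elim_inl, Sum.elim_inr,
      hmeanY, hmean10, hmean11, hmean20, hmean22, Finset.sum_const, Finset.card_univ,
      Fintype.card_fin, nsmul_eq_mul]
    field_simp
    ring
  · rw [hθX, variance_sum_const_mul_of_iIndepFun hindep hX]
    simp only [c, Fintype.sum_sum_type, Sum.elim_inl, Sum.elim_inr, hvarY,
      fun i => (hvar i).1, fun i => (hvar i).2.1, fun i => (hvar i).2.2.1,
      fun i => (hvar i).2.2.2, Finset.sum_const, Finset.card_univ,
      Fintype.card_fin, nsmul_eq_mul, hm']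
    field_simp
    ring
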